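/- (A model with non-monotonic necessity operator) Consider the Boolean algebra of all subsets of {1,2} with set-theoretic complement and material implication f→(m,m') = mᶜ ∪ m', let TRUE = {{1,2},{1}}, and define f□ by f□({1,2})={1}, f□({2})={2}, f□({1})=∅, f□(∅)=∅. Then (P({1,2}), TRUE, f¬, f→, f□) satisfies all six model conditions (1)–(6), yet f□ is not monotonic: {2} ⊆ {1,2} but f□({2}) ⊄ f□({1,2}). -/

import Mathlib

/-- The set TRUE = {{1,2},{1}} of the counterexample model, with the two-element
set {1,2} modelled as `Set.univ : Set (Fin 2)` ( `0` plays the role of the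
element 1 and `1` the role of the element 2). -/
def TRUE2 : Set (Set (Fin 2)) := {Set.univ, {0}}

/-- Boolean implication f→(m,m') = mᶜ ∪ m' on the powerset of {1,2}. -/
def fImp2 (m m' : Set (Fin 2)) : Set (Fin 2) := mᶜ ∪ m'

open Classical in
/-- The necessity operation of the counterexample model:
f□({1,2}) = {1}, f□({2}) = {2}, f□({1}) = ∅, f□(∅) = ∅. -/
noncomputable def fBox2 (m : Set (Fin 2)) : Set (Fin 2) :=
  if m = Set.univ then {0} else if m = ({1} : Set (Fin 2)) then {1} else ∅

theorem mem_TRUE2_aux (m : Set (Fin 2)) : m ∈ TRUE2 ↔ (0 : Fin 2) ∈ m := by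
  simp only [TRUE2, Set.mem_insert_iff, Set.mem_singleton_iff, Set.ext_iff, Fin.forall_fin_two]
  simp
  tauto

theorem zero_mem_fBox2 (m : Set (Fin 2)) :
    (0 : Fin 2) ∈ fBox2 m ↔ (0 : Fin 2) ∈ m ∧ (1 : Fin 2) ∈ m := by
  unfold fBox2
  split_ifs with h1 h2
  · simp [h1]
  · simp [h2]
  · simp only [Set.ext_iff, Fin.forall_fin_two] at h1
    simp at h1 ⊢
    tauto

theorem one_mem_fBox2 (m : Set (Fin 2)) :
    (1 : Fin 2) ∈ fBox2 m ↔ (0 : Fin 2) ∉ m ∧ (1 : Fin 2) ∈ m := by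
  unfold fBox2
  split_ifs with h1 h2
  · simp [h1]
  · simp [h2]
  · simp only [Set.ext_iff, Fin.forall_fin_two] at h2
    simp at h2 ⊢
    tauto

/-- The powerset algebra of {1,2} with TRUE = {{1,2},{1}} and the above f□
satisfies the model conditions (1)–(6), yet f□ is not monotonic:
{2} ⊆ {1,2} but f□({2}) ⊈ f□({1,2}). -/
theorem nonmonotonic_model :
    (∅ : Set (Fin 2)) ∉ TRUE2 ∧ (Set.univ : Set (Fin 2)) ∈ TRUE2 ∧
    (∀ m : Set (Fin 2), mᶜ ∈ TRUE2 ↔ m ∉ TRUE2) ∧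
    (∀ m m' : Set (Fin 2), fImp2 m m' ∈ TRUE2 ↔ (m ∉ TRUE2 ∨ m' ∈ TRUE2)) ∧
    (∀ m : Set (Fin 2), fBox2 m ∈ TRUE2 ↔ m = Set.univ) ∧
    (∀ m : Set (Fin 2), fBox2 m ⊆ m) ∧
    (∀ m m' m'' : Set (Fin 2),
      fBox2 (fImp2 m m') ∩ fBox2 (fImp2 m' m'') ⊆ fBox2 (fImp2 m m'')) ∧
    ({1} : Set (Fin 2)) ⊆ Set.univ ∧
    ¬ fBox2 {1} ⊆ fBox2 Set.univ := by
  simp only [mem_TRUE2_aux, zero_mem_fBox2, one_mem_fBox2, fImp2, Set.subset_def, Set.ext_iff,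
    Fin.forall_fin_two, Set.mem_inter_iff, Set.mem_union, Set.mem_compl_iff, Set.mem_univ,
    Set.mem_empty_iff_false, Set.mem_singleton_iff]
  refine ⟨by simp, by simp, fun m => by tauto, fun m m' => by tauto, fun m => by tauto,
    fun m => by tauto, fun m m' m'' => by tauto, by simp, by simp⟩
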